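/- arXiv:1303.0815 — 2 statements merged into one kernel-verified Lean document; each statement's English description precedes it below -/
import Mathlib

section
/- Let μ ≤ λ be infinite cardinals. A topological space X is [μ,λ]-compact if and only if for every sequence of elements of X indexed by the set [λ]^{<μ} of subsets of λ of cardinality less than μ, there exists an ultrafilter D on [λ]^{<μ} such that {Z ∈ [λ]^{<μ} : α ∈ Z} ∈ D for every α ∈ λ, and the sequence D-converges to some point of X. -/
universe u

/-- `X` is `[μ, λ]`-compact if every open cover of `X` of cardinality at most `λ`
has a subcover of cardinality strictly less than `μ`. -/
def IntervalCompact (μ lam : Cardinal.{u}) (X : Type u) [TopologicalSpace X] : Prop :=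
  ∀ 𝒰 : Set (Set X), (∀ U ∈ 𝒰, IsOpen U) → ⋃₀ 𝒰 = Set.univ → Cardinal.mk 𝒰 ≤ lam →
    ∃ 𝒱 ⊆ 𝒰, Cardinal.mk 𝒱 < μ ∧ ⋃₀ 𝒱 = Set.univ

/-- A sequence `x : I → X` `F`-converges to `p` if for every open neighborhood `U` of `p`,
the set `{i | x i ∈ U}` belongs to `F`. -/
def FLimit {I : Type u} {X : Type u} [TopologicalSpace X] (F : Filter I)
    (x : I → X) (p : X) : Prop :=
  ∀ U : Set X, IsOpen U → p ∈ U → {i | x i ∈ U} ∈ F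

open Cardinal Filter Topology

/-- A union of fewer than `μ` finite sets has cardinality less than `μ`, for infinite `μ`. -/
theorem Cardinal.mk_iUnion_finset_lt {ι α : Type u} {μ : Cardinal.{u}} (hμ : ℵ₀ ≤ μ)
    (hι : #ι < μ) (F : ι → Finset α) : #(⋃ i, (F i : Set α)) < μ := by
  cases finite_or_infinite ι with
  | inl _ =>
    exact (Cardinal.lt_aleph0_iff_set_finite.2
      (Set.finite_iUnion fun i => (F i).finite_toSet)).trans_le hμ
  | inr _ =>
    refine lt_of_le_of_lt ?_ hι
    calc #(⋃ i, (F i : Set α)) ≤ sum fun i => #(F i : Set α) := mk_iUnion_le_sum_mk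
      _ ≤ sum fun _ : ι => ℵ₀ := sum_le_sum _ _ fun i =>
        (Cardinal.lt_aleph0_iff_set_finite.2 (F i).finite_toSet).le
      _ = #ι := by rw [sum_const', mul_aleph0_eq (aleph0_le_mk ι)]

/-- In a `[μ, λ]`-compact space, every sequence indexed by `[λ]^{<μ}` has a cluster point along
the filter generated by the sets `{Z | F ⊆ Z}` with `F` a finite subset of `λ`. -/
theorem IntervalCompact.exists_mapClusterPt {A X : Type u} [Infinite A] [TopologicalSpace X]
    {μ : Cardinal.{u}} (hμ : ℵ₀ ≤ μ) (hX : IntervalCompact μ #A X)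
    (x : {Z : Set A // #Z < μ} → X) :
    ∃ p, MapClusterPt p (⨅ F : Finset A, 𝓟 {Z : {Z : Set A // #Z < μ} | (F : Set A) ⊆ Z.1}) x := by
  by_contra! h
  have hdir : Directed (· ≥ ·) fun F : Finset A =>
      𝓟 {Z : {Z : Set A // #Z < μ} | (F : Set A) ⊆ Z.1} := by
    refine directed_of_isDirected_le fun F G hFG => principal_mono.2 fun Z hZ => ?_
    exact (Finset.coe_subset.2 hFG).trans hZ
  let V : Finset A → Set X := fun F => (closure (x '' {Z | (F : Set A) ⊆ Z.1}))ᶜ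
  have hcover : ⋃₀ Set.range V = Set.univ := by
    refine Set.eq_univ_of_forall fun p => ?_
    obtain ⟨U, hU, hxU⟩ : ∃ U ∈ 𝓝 p, ∀ᶠ Z in ⨅ F : Finset A,
        𝓟 {Z : {Z : Set A // #Z < μ} | (F : Set A) ⊆ Z.1}, x Z ∉ U := by
      simpa [mapClusterPt_iff_frequently] using h p
    obtain ⟨F, hF⟩ := (mem_iInf_of_directed hdir _).1 hxU
    refine Set.mem_sUnion.2 ⟨V F, ⟨F, rfl⟩, fun hp => ?_⟩
    obtain ⟨_, hy, Z, hZ, rfl⟩ := mem_closure_iff_nhds.1 hp U hU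
    exact hF hZ hy
  obtain ⟨𝒱, hsub, hcard, h𝒱⟩ := hX (Set.range V)
    (Set.forall_mem_range.2 fun F => isClosed_closure.isOpen_compl) hcover
    (mk_range_le.trans (mk_finset_of_infinite A).le)
  choose F hF using fun v : 𝒱 => hsub v.2
  let Z : {Z : Set A // #Z < μ} := ⟨⋃ v, (F v : Set A), mk_iUnion_finset_lt hμ hcard F⟩
  obtain ⟨v, hv, hxv⟩ := Set.mem_sUnion.1 (h𝒱 ▸ Set.mem_univ (x Z))
  have hxV : x Z ∈ V (F ⟨v, hv⟩) := (hF ⟨v, hv⟩).symm ▸ hxv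
  exact hxV (subset_closure ⟨Z, Set.subset_iUnion (fun v => (F v : Set A)) ⟨v, hv⟩, rfl⟩)

/-- `X` is `[μ, λ]`-compact iff every sequence indexed by `[λ]^{<μ}` (the subsets of
`λ` of cardinality `< μ`) `D`-converges to some point of `X`, for some ultrafilter `D`
on `[λ]^{<μ}` containing all sets `{Z ∈ [λ]^{<μ} : α ∈ Z}` for `α ∈ λ`. -/
theorem intervalCompact_iff_ultrafilter (μ lam : Cardinal.{u})
    (hμ : Cardinal.aleph0 ≤ μ) (hml : μ ≤ lam)
    (X : Type u) [TopologicalSpace X] :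
    IntervalCompact μ lam X ↔
      ∀ x : {Z : Set (Quotient.out lam) // Cardinal.mk Z < μ} → X,
        ∃ D : Ultrafilter {Z : Set (Quotient.out lam) // Cardinal.mk Z < μ},
          (∀ α : Quotient.out lam,
            {Z : {Z : Set (Quotient.out lam) // Cardinal.mk Z < μ} | α ∈ Z.1} ∈ D) ∧
          ∃ p : X, FLimit (D : Filter _) x p := by
  have : Infinite lam.out := infinite_iff.2 (by rw [mk_out]; exact hμ.trans hml)
  constructor
  · intro hX x
    obtain ⟨p, hp⟩ := IntervalCompact.exists_mapClusterPt hμ (by rwa [mk_out]) x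
    obtain ⟨D, hD, hDp⟩ := mapClusterPt_iff_ultrafilter.1 hp
    refine ⟨D, fun α => ?_, p, fun U hU hpU => hDp (hU.mem_nhds hpU)⟩
    refine hD (mem_iInf_of_mem {α} ?_)
    simp
  · intro h 𝒰 hopen hcover hcard
    by_contra! hno
    obtain ⟨e⟩ : Nonempty (𝒰 ↪ lam.out) := by rwa [← Cardinal.le_def, mk_out]
    have hmiss (Z : {Z : Set lam.out // #Z < μ}) : ∃ y, ∀ U : 𝒰, e U ∈ Z.1 → y ∉ U.1 := by
      have hlt : #(Subtype.val '' (e ⁻¹' Z.1)) < μ :=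
        mk_image_le.trans_lt ((mk_preimage_of_injective e Z.1 e.injective).trans_lt Z.2)
      obtain ⟨y, hy⟩ := (Set.ne_univ_iff_exists_notMem _).1
        (hno _ (Subtype.coe_image_subset 𝒰 _) hlt)
      exact ⟨y, fun U hU hyU => hy ⟨U, ⟨U, hU, rfl⟩, hyU⟩⟩
    choose x hx using hmiss
    obtain ⟨D, hD, p, hp⟩ := h x
    obtain ⟨U, hU, hpU⟩ := Set.mem_sUnion.1 (hcover ▸ Set.mem_univ p)
    obtain ⟨Z, hZ, hxZ⟩ := D.nonempty_of_mem (inter_mem (hD (e ⟨U, hU⟩)) (hp U (hopen U hU) hpU))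
    exact hx Z ⟨U, hU⟩ hZ hxZ
end

section
/- Let μ ≤ λ be infinite cardinals. A topological space X is [μ,λ]-compact if and only if both (i) X is [ν,ν]-compact for every regular cardinal ν with μ ≤ ν ≤ λ, and (ii) X is [μ,ν]-compact for every singular cardinal ν of cofinality strictly less than μ with μ ≤ ν ≤ λ. -/
universe u

open Cardinal Order in
/-- If `X` is `[cf κ, cf κ]`-compact, then every open cover of infinite cardinality `κ` has a
subcover of strictly smaller cardinality. -/
theorem IntervalCompact.exists_subcover_mk_lt {X : Type u} [TopologicalSpace X]
    {𝒰 : Set (Set X)} (hopen : ∀ U ∈ 𝒰, IsOpen U) (hcov : ⋃₀ 𝒰 = Set.univ)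
    (hinf : ℵ₀ ≤ #𝒰) (h : IntervalCompact (#𝒰).ord.cof (#𝒰).ord.cof X) :
    ∃ 𝒱 ⊆ 𝒰, #𝒱 < #𝒰 ∧ ⋃₀ 𝒱 = Set.univ := by
  have := noMaxOrder hinf
  obtain ⟨f⟩ : Nonempty ((#𝒰).ord.ToType ≃ 𝒰) := Cardinal.eq.1 (mk_ord_toType _)
  obtain ⟨S, hS, hScard⟩ := exists_cof_eq (#𝒰).ord.ToType
  rw [Ordinal.cof_toType] at hScard
  let W (t : (#𝒰).ord.ToType) : Set X := ⋃ i ∈ Set.Iio t, (f i : Set X)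
  have W_mono {s t} (hst : s ≤ t) : W s ⊆ W t :=
    Set.biUnion_subset_biUnion_left (Set.Iio_subset_Iio hst)
  obtain ⟨𝒱, h𝒱, h𝒱card, h𝒱cov⟩ := h (W '' S)
    (by
      rintro _ ⟨t, -, rfl⟩
      exact isOpen_biUnion fun i _ ↦ hopen _ (f i).2)
    (by
      refine Set.eq_univ_of_forall fun x ↦ ?_
      obtain ⟨U, hU, hx⟩ := hcov.ge (Set.mem_univ x)
      obtain ⟨t, ht⟩ := exists_gt (f.symm ⟨U, hU⟩)
      obtain ⟨s, hs, hts⟩ := hS t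
      exact ⟨W s, ⟨s, hs, rfl⟩, Set.mem_biUnion (ht.trans_le hts) (by simpa using hx)⟩)
    (mk_image_le.trans hScard.le)
  choose g _ hgW using fun V : 𝒱 ↦ h𝒱 V.2
  have hg : ¬ IsCofinal (Set.range g) := fun hc ↦
    (((cof_le hc).trans mk_range_le).trans_lt h𝒱card).ne (Ordinal.cof_toType _)
  obtain ⟨t, ht⟩ := not_isCofinal_iff.1 hg
  refine ⟨(fun i ↦ (f i : Set X)) '' Set.Iio t, ?_,
    mk_image_le.trans_lt ((mk_Iio_lt t (by simp)).trans_eq (mk_ord_toType _)), ?_⟩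
  · rintro _ ⟨i, -, rfl⟩
    exact (f i).2
  · rw [Set.sUnion_image, ← Set.univ_subset_iff, ← h𝒱cov]
    refine Set.sUnion_subset fun V hV ↦ ?_
    exact (hgW ⟨V, hV⟩).ge.trans (W_mono (ht _ (Set.mem_range_self _)).le)

/-- `[μ, λ]`-compactness is inherited by smaller intervals. -/
theorem IntervalCompact.mono {μ μ' lam lam' : Cardinal.{u}} {X : Type u} [TopologicalSpace X]
    (h : IntervalCompact μ lam X) (hμ : μ ≤ μ') (hlam : lam' ≤ lam) :
    IntervalCompact μ' lam' X := fun 𝒰 hopen hcov hcard ↦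
  let ⟨𝒱, h𝒱, h𝒱card, h𝒱cov⟩ := h 𝒰 hopen hcov (hcard.trans hlam)
  ⟨𝒱, h𝒱, h𝒱card.trans_le hμ, h𝒱cov⟩

/-- `[μ, λ]`-compactness is equivalent to the conjunction of `[ν, ν]`-compactness for
all regular `ν ∈ [μ, λ]` and `[μ, ν]`-compactness for all singular `ν ∈ [μ, λ]` of
cofinality `< μ`. -/
theorem intervalCompact_iff_regular_and_singular (μ lam : Cardinal.{u})
    (hμ : Cardinal.aleph0 ≤ μ) (hml : μ ≤ lam)
    (X : Type u) [TopologicalSpace X] :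
    IntervalCompact μ lam X ↔
      ((∀ ν : Cardinal.{u}, μ ≤ ν → ν ≤ lam → ν.IsRegular → IntervalCompact ν ν X) ∧
       (∀ ν : Cardinal.{u}, μ ≤ ν → ν ≤ lam → ¬ ν.IsRegular → ν.ord.cof < μ →
          IntervalCompact μ ν X)) := by
  refine ⟨fun h ↦ ⟨fun ν hμν hν _ ↦ h.mono hμν hν, fun ν _ hν _ _ ↦ h.mono le_rfl hν⟩, ?_⟩
  rintro ⟨hreg, hsing⟩ 𝒰 hopen hcov hcard
  induction hκ : Cardinal.mk 𝒰 using WellFoundedLT.induction generalizing 𝒰 with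
  | ind κ ih =>
    subst hκ
    rcases lt_or_ge (Cardinal.mk 𝒰) μ with hlt | hge
    · exact ⟨𝒰, subset_rfl, hlt, hcov⟩
    have hinf := hμ.trans hge
    rcases lt_or_ge (Cardinal.mk 𝒰).ord.cof μ with hcof | hcof
    · exact hsing _ hge hcard (fun hr ↦ (hcof.trans_le hge).ne hr.cof_ord) hcof 𝒰 hopen hcov le_rfl
    · obtain ⟨𝒱, h𝒱, h𝒱card, h𝒱cov⟩ := IntervalCompact.exists_subcover_mk_lt hopen hcov hinf
        (hreg _ hcof ((Ordinal.cof_ord_le _).trans hcard)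
          (Cardinal.isRegular_cof (Cardinal.isSuccLimit_ord hinf)))
      obtain ⟨𝒲, h𝒲, h𝒲card, h𝒲cov⟩ := ih _ h𝒱card 𝒱 (fun U hU ↦ hopen U (h𝒱 hU)) h𝒱cov
        (h𝒱card.le.trans hcard) rfl
      exact ⟨𝒲, h𝒲.trans h𝒱, h𝒲card, h𝒲cov⟩
end
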